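/- arXiv:1102.1809 — 2 statements merged into one kernel-verified Lean document; each statement's English description precedes it below -/
import Mathlib

section
/- Barnett's formula: let f, g ∈ ℂ[x] with g monic of degree m (and deg f ≤ m). Let M_f be the m×m matrix of the multiplication-by-f map on ℂ[x]/(g) in the monomial basis 1, x, …, x^{m−1}. Then B_{1,g} is invertible and M_f = B_{f,g} · B_{1,g}^{−1}, where B_{f,g} and B_{1,g} are the Bézout matrices of the pairs (f,g) and (1,g). -/
open Polynomial

theorem bz_rec0 (f g : ℂ[X]) (T : Polynomial (Polynomial ℂ))
    (h : T * (Polynomial.C X - X) = Polynomial.C f * g.map Polynomial.C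
            - Polynomial.C g * f.map Polynomial.C) (i : ℕ) :
    (T.coeff 0).coeff i = f.coeff (i+1) * g.coeff 0 - g.coeff (i+1) * f.coeff 0 := by
  have := congrArg (fun p => (Polynomial.coeff p 0).coeff (i+1)) h
  simpa [mul_sub] using this

theorem bz_rec (f g : ℂ[X]) (T : Polynomial (Polynomial ℂ))
    (h : T * (Polynomial.C X - X) = Polynomial.C f * g.map Polynomial.C
            - Polynomial.C g * f.map Polynomial.C) (i j : ℕ) :
    (T.coeff (j+1)).coeff i = (T.coeff j).coeff (i+1) +
      (f.coeff (i+1) * g.coeff (j+1) - g.coeff (i+1) * f.coeff (j+1)) := by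
  have := congrArg (fun p => (Polynomial.coeff p (j+1)).coeff (i+1)) h
  simp only [mul_sub, coeff_sub, coeff_mul_C, coeff_C_mul, coeff_mul_X, coeff_map] at this
  rw [← this]; ring

theorem bz_deg (m : ℕ) (f g : ℂ[X]) (hg : g.natDegree ≤ m) (hf : f.natDegree ≤ m)
    (T : Polynomial (Polynomial ℂ))
    (h : T * (Polynomial.C X - X) = Polynomial.C f * g.map Polynomial.C
            - Polynomial.C g * f.map Polynomial.C) (j : ℕ) :
    ∀ i, m ≤ i → (T.coeff j).coeff i = 0 := by
  have hf' : ∀ i, m ≤ i → f.coeff (i+1) = 0 := fun i hi =>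
    coeff_eq_zero_of_natDegree_lt (by omega)
  have hg' : ∀ i, m ≤ i → g.coeff (i+1) = 0 := fun i hi =>
    coeff_eq_zero_of_natDegree_lt (by omega)
  induction j with
  | zero => intro i hi; rw [bz_rec0 f g T h, hf' i hi, hg' i hi]; simp
  | succ j ih =>
    intro i hi
    rw [bz_rec f g T h, hf' i hi, hg' i hi, ih (i+1) (by omega)]; simp

theorem bz_sum (m : ℕ) (g p : ℂ[X]) (hp : ∀ i, m ≤ i → p.coeff i = 0)
    (b : Module.Basis (Fin m) ℂ (ℂ[X] ⧸ Ideal.span {g}))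
    (hb : ∀ i : Fin m, b i = Ideal.Quotient.mk (Ideal.span {g}) (X ^ (i : ℕ))) :
    Ideal.Quotient.mk (Ideal.span {g}) p = ∑ i : Fin m, p.coeff i • b i := by
  have h : p = ∑ i : Fin m, p.coeff (i : ℕ) • (X : ℂ[X]) ^ (i : ℕ) := by
    rw [Fin.sum_univ_eq_sum_range (fun i => p.coeff i • (X : ℂ[X]) ^ i) m]
    ext k
    simp only [finset_sum_coeff, coeff_smul, coeff_X_pow, smul_eq_mul, mul_ite, mul_one, mul_zero,
      Finset.sum_ite_eq, Finset.mem_range]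
    split_ifs with hk
    · rfl
    · exact hp k (by omega)
  conv_lhs => rw [h]
  rw [map_sum]
  refine Finset.sum_congr rfl fun i _ => ?_
  rw [hb]
  rfl

theorem bz_hankel (g : ℂ[X]) (T : Polynomial (Polynomial ℂ))
    (h : T * (Polynomial.C X - X) = Polynomial.C 1 * g.map Polynomial.C
            - Polynomial.C g * (1 : ℂ[X]).map Polynomial.C) (j : ℕ) :
    ∀ i, (T.coeff j).coeff i = - g.coeff (i + j + 1) := by
  induction j with
  | zero => intro i; rw [bz_rec0 1 g T h]; simp [coeff_one]
  | succ j ih =>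
    intro i
    rw [bz_rec 1 g T h, ih]; simp [coeff_one]; congr 1; omega

theorem bz_unit (m : ℕ) (g : ℂ[X]) (hg : g.Monic) (hm : g.natDegree = m)
    (B : Matrix (Fin m) (Fin m) ℂ)
    (hB : ∀ i j : Fin m, B i j = - g.coeff ((i : ℕ) + j + 1)) : IsUnit B := by
  rw [← Matrix.isUnit_submatrix_equiv (Equiv.refl (Fin m)) Fin.revPerm, Matrix.isUnit_iff_isUnit_det,
    Matrix.det_of_upperTriangular]
  · rw [Finset.prod_congr rfl (g := fun _ => (-1 : ℂ))]
    · simp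
    · intro i _
      have : (i : ℕ) + (m - (i + 1)) + 1 = g.natDegree := by omega
      simp [hB, Fin.val_rev, this, hg]
  · intro i j hij
    have hij' : (j : ℕ) < i := hij
    simp only [Matrix.submatrix_apply, hB, Equiv.refl_apply, Fin.revPerm_apply, Fin.val_rev]
    rw [coeff_eq_zero_of_natDegree_lt (by omega), neg_zero]

theorem bz_cong (f g : ℂ[X]) (T S : Polynomial (Polynomial ℂ))
    (h1 : T * (Polynomial.C X - X) = Polynomial.C f * g.map Polynomial.C
            - Polynomial.C g * f.map Polynomial.C)
    (h2 : S * (Polynomial.C X - X) = g.map Polynomial.C - Polynomial.C g) (j : ℕ) :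
    Ideal.Quotient.mk (Ideal.span {g}) (T.coeff j) =
      Ideal.Quotient.mk (Ideal.span {g}) f * Ideal.Quotient.mk (Ideal.span {g}) (S.coeff j) := by
  set q := Ideal.Quotient.mk (Ideal.span {g})
  have hq : q g = 0 := Ideal.Quotient.eq_zero_iff_mem.2 (Ideal.mem_span_singleton_self g)
  have e1 := congrArg (Polynomial.map q) h1
  have e2 := congrArg (Polynomial.map q) h2
  simp only [Polynomial.map_mul, Polynomial.map_sub, Polynomial.map_C, Polynomial.map_X, hq,
    Polynomial.C_0, zero_mul, sub_zero] at e1 e2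
  have e : T.map q = Polynomial.C (q f) * S.map q := by
    apply (monic_X_sub_C (q X)).isRegular.right
    simp only
    linear_combination -e1 + Polynomial.C (q f) * e2
  have := congrArg (fun p => Polynomial.coeff p j) e
  simpa using this

/-- Barnett's formula: let `f, g ∈ ℂ[x]` with `g` monic of degree `m` and `deg f ≤ m`.
Let `M_f` be the `m×m` matrix of the multiplication-by-`f` map on `ℂ[x]/(g)` in the
monomial basis `1, x, …, x^{m−1}`.  Then the Bézout matrix `B_{1,g}` is invertible and
`M_f = B_{f,g} · B_{1,g}⁻¹`.

The Bézout matrices are the coefficient matrices of the bivariate Bézout polynomials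
`Θ_{f,g}(x,y) = (f(x)g(y) − f(y)g(x))/(x − y)` and `Θ_{1,g}(x,y) = (g(y) − g(x))/(x − y)`,
elements of `(ℂ[x])[y]` characterized by the product identities below. -/
theorem barnett_formula (m : ℕ) (f g : ℂ[X]) (hg : g.Monic)
    (hm : g.natDegree = m) (hf : f.natDegree ≤ m)
    (b : Module.Basis (Fin m) ℂ (ℂ[X] ⧸ Ideal.span {g}))
    (hb : ∀ i : Fin m, b i = Ideal.Quotient.mk (Ideal.span {g}) (X ^ (i : ℕ)))
    (Θfg Θ1g : Polynomial (Polynomial ℂ))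
    (h1 : Θfg * (Polynomial.C X - X) = Polynomial.C f * g.map Polynomial.C
            - Polynomial.C g * f.map Polynomial.C)
    (h2 : Θ1g * (Polynomial.C X - X) = g.map Polynomial.C - Polynomial.C g)
    (Bfg B1g : Matrix (Fin m) (Fin m) ℂ)
    (hBfg : ∀ i j : Fin m, Bfg i j = (Θfg.coeff (j : ℕ)).coeff (i : ℕ))
    (hB1g : ∀ i j : Fin m, B1g i j = (Θ1g.coeff (j : ℕ)).coeff (i : ℕ)) :
    IsUnit B1g ∧
      LinearMap.toMatrix b b
          (LinearMap.mulLeft ℂ (Ideal.Quotient.mk (Ideal.span {g}) f))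
        = Bfg * B1g⁻¹ := by
  have h2' : Θ1g * (Polynomial.C X - X) = Polynomial.C 1 * g.map Polynomial.C
            - Polynomial.C g * (1 : ℂ[X]).map Polynomial.C := by simpa using h2
  have hu : IsUnit B1g := bz_unit m g hg hm B1g fun i j => by
    rw [hB1g, bz_hankel g Θ1g h2']
  refine ⟨hu, ?_⟩
  have hdet := (Matrix.isUnit_iff_isUnit_det _).1 hu
  have key : LinearMap.toMatrix b b
          (LinearMap.mulLeft ℂ (Ideal.Quotient.mk (Ideal.span {g}) f)) * B1g = Bfg := by
    ext i j
    have c := bz_cong f g Θfg Θ1g h1 h2 j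
    rw [bz_sum m g _ (bz_deg m f g hm.le hf Θfg h1 j) b hb,
      bz_sum m g _ (bz_deg m 1 g hm.le (by simp) Θ1g h2' j) b hb] at c
    have c' := congrArg (fun v => b.repr v i) c
    simp only [Finset.mul_sum, mul_smul_comm, map_sum, map_smul, Finsupp.coe_finset_sum,
      Finset.sum_apply, Finsupp.smul_apply, Module.Basis.repr_self, smul_eq_mul,
      Finsupp.single_apply, mul_ite, mul_one, mul_zero, Finset.sum_ite_eq', Finset.mem_univ,
      if_true, Finset.sum_ite_eq] at c'
    rw [hBfg, c', Matrix.mul_apply]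
    refine Finset.sum_congr rfl fun k _ => ?_
    rw [LinearMap.toMatrix_apply, LinearMap.mulLeft_apply, hB1g, mul_comm]
  rw [← key, Matrix.mul_assoc, Matrix.mul_nonsing_inv _ hdet, Matrix.mul_one]
end

section
/- Let f ∈ ℂ[x] be monic of degree n, let g ∈ ℂ[x], and let M_g be the n×n matrix of the multiplication-by-g map on ℂ[x]/(f) in the monomial basis. Then for any θ ∈ ℂ with |θ| = 1, the Toeplitz-like displacement ∇_T(M_g) = Z_n^1 M_g − M_g Z_n^θ has rank at most 2; i.e., M_g is a Toeplitz-like matrix of displacement rank at most 2. -/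
open Polynomial

/-- The `n×n` circulant matrix `Z_n^θ`: ones on the subdiagonal, the entry `θ` in position
`(1, n)` (i.e. index `(0, n−1)`), zeros elsewhere. -/
def Zcirc (n : ℕ) (θ : ℂ) : Matrix (Fin n) (Fin n) ℂ :=
  fun i j =>
    if (i : ℕ) = (j : ℕ) + 1 then 1
    else if (i : ℕ) = 0 ∧ (j : ℕ) = n - 1 then θ else 0

lemma matrix_rank_add_le (n : ℕ) (A B : Matrix (Fin n) (Fin n) ℂ) :
    (A + B).rank ≤ A.rank + B.rank := by
  unfold Matrix.rank
  rw [Matrix.mulVecLin_add]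
  refine le_trans (Submodule.finrank_mono ?_)
    (Submodule.finrank_add_le_finrank_add_finrank _ _)
  rintro _ ⟨x, rfl⟩
  exact Submodule.add_mem_sup ⟨x, rfl⟩ ⟨x, rfl⟩

lemma rank_le_one_of_lastCol (n : ℕ) (D : Matrix (Fin n) (Fin n) ℂ)
    (h : ∀ i j : Fin n, (j : ℕ) + 1 < n → D i j = 0) : D.rank ≤ 1 := by
  cases n with
  | zero => exact (Matrix.rank_le_width D).trans (by omega)
  | succ m =>
    have : D = Matrix.vecMulVec (fun i => D i (Fin.last m))
        (fun j => if j = Fin.last m then 1 else 0) := by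
      ext i j
      rw [Matrix.vecMulVec_apply]
      split_ifs with hj
      · rw [hj, mul_one]
      · rw [mul_zero]
        apply h
        have := Fin.val_lt_last hj
        omega
    rw [this]
    exact Matrix.rank_vecMulVec_le _ _

lemma Zcirc_sub_rank (n : ℕ) (f : ℂ[X])
    (b : Module.Basis (Fin n) ℂ (ℂ[X] ⧸ Ideal.span {f}))
    (hb : ∀ i : Fin n, b i = Ideal.Quotient.mk (Ideal.span {f}) (X ^ (i : ℕ))) (θ : ℂ) :
    (Zcirc n θ - LinearMap.toMatrix b b
      (LinearMap.mulLeft ℂ (Ideal.Quotient.mk (Ideal.span {f}) X))).rank ≤ 1 := by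
  apply rank_le_one_of_lastCol
  intro i j hj
  have h1 : Ideal.Quotient.mk (Ideal.span {f}) X * b j = b ⟨j + 1, hj⟩ := by
    rw [hb, hb, ← map_mul, pow_succ']
  rw [Matrix.sub_apply, LinearMap.toMatrix_apply, LinearMap.mulLeft_apply, h1,
    Module.Basis.repr_self, Finsupp.single_apply, Zcirc]
  have h2 : ¬ ((i : ℕ) = 0 ∧ (j : ℕ) = n - 1) := by omega
  simp only [h2, if_false, Fin.ext_iff]
  simp [eq_comm]

/-- Let `f ∈ ℂ[x]` be monic of degree `n`, let `g ∈ ℂ[x]`, and let `M_g` be the `n×n`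
matrix of the multiplication-by-`g` map on `ℂ[x]/(f)` in the monomial basis.  For any
`θ ∈ ℂ` with `|θ| = 1`, the Toeplitz-like displacement `∇_T(M_g) = Z_n^1 M_g − M_g Z_n^θ`
has rank at most `2`: `M_g` is a Toeplitz-like matrix of displacement rank at most `2`. -/
theorem mul_matrix_displacement_rank (n : ℕ) (f g : ℂ[X]) (hf : f.Monic)
    (hn : f.natDegree = n)
    (b : Module.Basis (Fin n) ℂ (ℂ[X] ⧸ Ideal.span {f}))
    (hb : ∀ i : Fin n, b i = Ideal.Quotient.mk (Ideal.span {f}) (X ^ (i : ℕ)))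
    (Mg : Matrix (Fin n) (Fin n) ℂ)
    (hMg : Mg = LinearMap.toMatrix b b
            (LinearMap.mulLeft ℂ (Ideal.Quotient.mk (Ideal.span {f}) g)))
    (θ : ℂ) (hθ : ‖θ‖ = 1) :
    (Zcirc n 1 * Mg - Mg * Zcirc n θ).rank ≤ 2 := by
  set C := LinearMap.toMatrix b b
      (LinearMap.mulLeft ℂ (Ideal.Quotient.mk (Ideal.span {f}) X)) with hC
  have hcomm : C * Mg = Mg * C := by
    rw [hMg, hC, ← LinearMap.toMatrix_mul, ← LinearMap.toMatrix_mul]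
    refine congrArg (LinearMap.toMatrix b b) (LinearMap.ext fun x => ?_)
    rw [Module.End.mul_apply, Module.End.mul_apply, LinearMap.mulLeft_apply,
      LinearMap.mulLeft_apply, LinearMap.mulLeft_apply, LinearMap.mulLeft_apply]
    exact mul_left_comm _ _ x
  have key : Zcirc n 1 * Mg - Mg * Zcirc n θ
      = (Zcirc n 1 - C) * Mg + Mg * (-(Zcirc n θ - C)) := by
    rw [neg_sub, sub_mul, mul_sub, hcomm]
    abel
  have hneg : (-(Zcirc n θ - C)).rank ≤ 1 := by
    have e : -(Zcirc n θ - C) = (Zcirc n θ - C) * (-1) := by simp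
    rw [e]
    refine (Matrix.rank_mul_le_left _ _).trans ?_
    exact Zcirc_sub_rank n f b hb θ
  rw [key]
  refine (matrix_rank_add_le n _ _).trans ?_
  have h1 := (Matrix.rank_mul_le_left (Zcirc n 1 - C) Mg).trans (Zcirc_sub_rank n f b hb 1)
  have h2 := (Matrix.rank_mul_le_right Mg (-(Zcirc n θ - C))).trans hneg
  omega
end
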